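/- arXiv:0803.1336 — 5 statements merged into one kernel-verified Lean document; each statement's English description precedes it below -/
import Mathlib

section
/- A finite group G is abelian if and only if there is a ℂ-algebra isomorphism between ℂ[G] and the product algebra ℂ^{|G|} (i.e., Fin |G| → ℂ with pointwise operations). -/
theorem Matrix.subsingleton_of_forall_mul_comm {n F : Type*} [Fintype n] [DecidableEq n]
    [Semiring F] [Nontrivial F] (h : ∀ A B : Matrix n n F, A * B = B * A) : Subsingleton n := by
  refine ⟨fun a b ↦ by_contra fun hab ↦ ?_⟩
  have key := congrFun₂ (h (Matrix.single a b 1) (Matrix.single b a 1)) a a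
  simp [Ne.symm hab] at key

/-- A commutative semisimple finite-dimensional algebra over an algebraically closed field is a
product of copies of the field. -/
theorem IsSemisimpleRing.nonempty_algEquiv_fin_pi (F R : Type*) [Field F] [IsAlgClosed F] [Ring R]
    [Algebra F R] [IsSemisimpleRing R] [FiniteDimensional F R] (h : ∀ x y : R, x * y = y * x) :
    Nonempty (R ≃ₐ[F] (Fin (Module.finrank F R) → F)) := by
  obtain ⟨n, d, hd, ⟨e⟩⟩ := IsSemisimpleRing.exists_algEquiv_pi_matrix_of_isAlgClosed F R
  have comm (x y : Π i, Matrix (Fin (d i)) (Fin (d i)) F) : x * y = y * x :=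
    e.symm.injective (by simp only [map_mul, h])
  obtain rfl : d = fun _ ↦ 1 := funext fun i ↦ by
    have : Subsingleton (Fin (d i)) :=
      Matrix.subsingleton_of_forall_mul_comm (F := F) fun A B ↦ by
        simpa using congrFun (comm (Pi.single i A) (Pi.single i B)) i
    have := Fin.subsingleton_iff_le_one.mp this
    have := (hd i).out
    omega
  let f : R ≃ₐ[F] (Fin n → F) := e.trans (.piCongrRight fun _ ↦ by
    convert Matrix.uniqueAlgEquiv (m := Fin 1) (R := F) (A := F))
  have hn : Module.finrank F R = n := by simpa using f.toLinearEquiv.finrank_eq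
  exact hn ▸ ⟨f⟩

/-- a finite group `G` is abelian if and only if `ℂ[G]` is isomorphic, as a
ℂ-algebra, to the product algebra `ℂ^{|G|}`. -/
theorem comm_iff_groupAlgebra_iso_pi (G : Type*) [Group G] [Fintype G] :
    (∀ a b : G, a * b = b * a) ↔
      Nonempty (MonoidAlgebra ℂ G ≃ₐ[ℂ] (Fin (Fintype.card G) → ℂ)) := by
  constructor
  · intro h
    let _ : CommGroup G := { ‹Group G› with mul_comm := h }
    have hG : Module.finrank ℂ (MonoidAlgebra ℂ G) = Fintype.card G := by
      simpa using (MonoidAlgebra.coeffLinearEquiv (S := ℂ) (M := G) ℂ).finrank_eq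
    have : NeZero (Nat.card G : ℂ) := ⟨Nat.cast_ne_zero.mpr Nat.card_pos.ne'⟩
    exact hG ▸ IsSemisimpleRing.nonempty_algEquiv_fin_pi ℂ (MonoidAlgebra ℂ G) mul_comm
  · rintro ⟨e⟩ a b
    apply MonoidAlgebra.of_injective (R := ℂ)
    apply e.injective
    simp only [map_mul, mul_comm]
end

section
/- Let χ : N →* ℂˣ be a character of N with stabilizer H_χ ≤ H, and let ψ : H_χ →* ℂˣ be a character of H_χ. Then the element v_χ * u_ψ of ℂ[G] is a primitive idempotent: it is nonzero, satisfies (v_χ u_ψ)² = v_χ u_ψ, and cannot be written as a sum of two nonzero orthogonal idempotents of ℂ[G]. -/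
open SemidirectProduct

/-- The action of `H` on characters of `N`: `(h • χ)(n) = χ(φ(h⁻¹) n)`. -/
def charAct {N H : Type*} [Group N] [Group H] (φ : H →* MulAut N)
    (h : H) (χ : N →* ℂˣ) : N →* ℂˣ :=
  χ.comp (φ h⁻¹).toMonoidHom

lemma charAct_one {N H : Type*} [Group N] [Group H] (φ : H →* MulAut N)
    (χ : N →* ℂˣ) : charAct φ 1 χ = χ := by
  ext n; simp [charAct]

lemma charAct_mul {N H : Type*} [Group N] [Group H] (φ : H →* MulAut N)
    (a b : H) (χ : N →* ℂˣ) :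
    charAct φ (a * b) χ = charAct φ a (charAct φ b χ) := by
  ext n; simp [charAct, mul_inv_rev, map_mul]

/-- The stabilizer `H_χ ≤ H` of the character `χ` of `N`. -/
def charStab {N H : Type*} [Group N] [Group H] (φ : H →* MulAut N)
    (χ : N →* ℂˣ) : Subgroup H where
  carrier := {h : H | charAct φ h χ = χ}
  one_mem' := charAct_one φ χ
  mul_mem' := by
    intro a b ha hb
    have ha' : charAct φ a χ = χ := ha
    have hb' : charAct φ b χ = χ := hb
    show charAct φ (a * b) χ = χ
    rw [charAct_mul, hb', ha']
  inv_mem' := by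
    intro a ha
    have ha' : charAct φ a χ = χ := ha
    show charAct φ a⁻¹ χ = χ
    conv_lhs => rw [← ha', ← charAct_mul, inv_mul_cancel, charAct_one]

/-- `v_χ = (1/|N|) Σ_{n ∈ N} χ(n)⁻¹ · (inl n)`. -/
noncomputable def vChar {N H : Type*} [Group N] [Fintype N] [Group H]
    (φ : H →* MulAut N) (χ : N →* ℂˣ) : MonoidAlgebra ℂ (N ⋊[φ] H) :=
  (Nat.card N : ℂ)⁻¹ • ∑ n : N,
    MonoidAlgebra.single (SemidirectProduct.inl n) ((((χ n)⁻¹ : ℂˣ) : ℂ))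

/-- `u_ψ = (1/|K|) Σ_{h ∈ K} ψ(h)⁻¹ · (inr h)`, for a character `ψ` of a subgroup `K ≤ H`. -/
noncomputable def uChar {N H : Type*} [Group N] [Group H]
    (φ : H →* MulAut N) (K : Subgroup H) (ψ : K →* ℂˣ) : MonoidAlgebra ℂ (N ⋊[φ] H) :=
  (Nat.card K : ℂ)⁻¹ • ∑ᶠ h : K,
    MonoidAlgebra.single (SemidirectProduct.inr (h : H)) ((((ψ h)⁻¹ : ℂˣ) : ℂ))


/-- A primitive idempotent: a nonzero idempotent that cannot be written as a sum of two
nonzero orthogonal idempotents. -/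
def IsPrimitiveIdempotent {A : Type*} [Ring A] (u : A) : Prop :=
  u ≠ 0 ∧ u * u = u ∧
    ¬ ∃ u₁ u₂ : A, u₁ ≠ 0 ∧ u₂ ≠ 0 ∧ u₁ * u₁ = u₁ ∧ u₂ * u₂ = u₂ ∧
      u₁ * u₂ = 0 ∧ u₂ * u₁ = 0 ∧ u = u₁ + u₂

section CharIdempotent

variable {K G : Type*} [Group K] [Fintype K] [Group G]

/-- The idempotent `(1/|K|) Σ_{k ∈ K} ψ(k)⁻¹ · f(k)` attached to a character `ψ` of `K` and a
homomorphism `f : K →* G`. -/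
noncomputable def charIdempotent (f : K →* G) (ψ : K →* ℂˣ) : MonoidAlgebra ℂ G :=
  (Nat.card K : ℂ)⁻¹ • ∑ k : K, MonoidAlgebra.single (f k) ((((ψ k)⁻¹ : ℂˣ) : ℂ))

lemma single_mul_charIdempotent (f : K →* G) (ψ : K →* ℂˣ) (k : K) :
    MonoidAlgebra.single (f k) (1 : ℂ) * charIdempotent f ψ
      = (ψ k : ℂ) • charIdempotent f ψ := by
  rw [charIdempotent, mul_smul_comm, smul_comm (ψ k : ℂ), Finset.mul_sum,
    Finset.smul_sum (r := (ψ k : ℂ))]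
  congr 1
  rw [← Equiv.sum_comp (Equiv.mulLeft k)
    (fun j => (ψ k : ℂ) • MonoidAlgebra.single (f j) ((((ψ j)⁻¹ : ℂˣ) : ℂ)))]
  refine Finset.sum_congr rfl fun j _ => ?_
  simp [MonoidAlgebra.single_mul_single, mul_left_comm (ψ k : ℂ)]

lemma charIdempotent_mul_single (f : K →* G) (ψ : K →* ℂˣ) (k : K) :
    charIdempotent f ψ * MonoidAlgebra.single (f k) (1 : ℂ)
      = (ψ k : ℂ) • charIdempotent f ψ := by
  rw [charIdempotent, smul_mul_assoc, smul_comm (ψ k : ℂ), Finset.sum_mul,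
    Finset.smul_sum (r := (ψ k : ℂ))]
  congr 1
  rw [← Equiv.sum_comp (Equiv.mulRight k)
    (fun j => (ψ k : ℂ) • MonoidAlgebra.single (f j) ((((ψ j)⁻¹ : ℂˣ) : ℂ)))]
  refine Finset.sum_congr rfl fun j _ => ?_
  simp [MonoidAlgebra.single_mul_single]

lemma charIdempotent_mul_self (f : K →* G) (ψ : K →* ℂˣ) :
    charIdempotent f ψ * charIdempotent f ψ = charIdempotent f ψ := by
  have key : ∀ k : K, MonoidAlgebra.single (f k) ((((ψ k)⁻¹ : ℂˣ) : ℂ)) * charIdempotent f ψ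
      = charIdempotent f ψ := fun k => by
    have : MonoidAlgebra.single (f k) ((((ψ k)⁻¹ : ℂˣ) : ℂ))
        = (((ψ k)⁻¹ : ℂˣ) : ℂ) • MonoidAlgebra.single (f k) (1 : ℂ) := by simp
    rw [this, smul_mul_assoc, single_mul_charIdempotent, smul_smul, Units.inv_mul, one_smul]
  conv_lhs => enter [1]; rw [charIdempotent]
  rw [smul_mul_assoc, Finset.sum_mul, Finset.sum_congr rfl fun k _ => key k, Finset.sum_const,
    Finset.card_univ, ← Nat.card_eq_fintype_card, ← Nat.cast_smul_eq_nsmul ℂ, smul_smul,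
    inv_mul_cancel₀ (Nat.cast_ne_zero.mpr Nat.card_pos.ne'), one_smul]

lemma charIdempotent_mul_of_ne (f : K →* G) {χ χ' : K →* ℂˣ} (h : χ ≠ χ') :
    charIdempotent f χ * charIdempotent f χ' = 0 := by
  obtain ⟨k, hk⟩ := DFunLike.ne_iff.mp h
  have h1 : (χ k : ℂ) • (charIdempotent f χ * charIdempotent f χ')
      = (χ' k : ℂ) • (charIdempotent f χ * charIdempotent f χ') := by
    rw [← smul_mul_assoc, ← charIdempotent_mul_single, mul_assoc, single_mul_charIdempotent,
      mul_smul_comm]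
  rw [← sub_eq_zero, ← sub_smul] at h1
  exact (smul_eq_zero.mp h1).resolve_left (sub_ne_zero.mpr fun h2 => hk (Units.ext h2))

end CharIdempotent

/-- A nonzero idempotent `e` of an algebra over a field such that `e A e` consists of scalar
multiples of `e` is primitive. -/
lemma isPrimitiveIdempotent_of_corner_scalar {k A : Type*} [Field k] [Ring A] [Algebra k A]
    {e : A} (h0 : e ≠ 0) (he : e * e = e) (h : ∀ x, ∃ c : k, e * x * e = c • e) :
    IsPrimitiveIdempotent e := by
  refine ⟨h0, he, ?_⟩
  rintro ⟨a, b, ha, hb, haa, hbb, hab, hba, rfl⟩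
  obtain ⟨c, hc⟩ := h a
  have h1 : a = c • (a + b) := by
    rw [← hc, add_mul, hba, add_zero, haa, mul_add, haa, hab, add_zero]
  have h2 : c • b = 0 := by
    have := congrArg (· * b) h1
    simpa [add_mul, hab, hbb] using this.symm
  rcases smul_eq_zero.mp h2 with hc0 | hb0
  · exact ha (by rw [h1, hc0, zero_smul])
  · exact hb hb0

lemma uChar_eq_charIdempotent {N H : Type*} [Group N] [Group H] (φ : H →* MulAut N)
    (K : Subgroup H) [Fintype K] (ψ : K →* ℂˣ) :
    uChar φ K ψ = charIdempotent (SemidirectProduct.inr.comp K.subtype) ψ := by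
  simp [uChar, charIdempotent, finsum_eq_sum_of_fintype]

section

variable {N H : Type*} [Group N] [Fintype N] [Group H] (φ : H →* MulAut N)

lemma single_inr_mul_vChar (χ : N →* ℂˣ) (h : H) :
    MonoidAlgebra.single (SemidirectProduct.inr h) (1 : ℂ) * vChar φ χ
      = vChar φ (charAct φ h χ) * MonoidAlgebra.single (SemidirectProduct.inr h) (1 : ℂ) := by
  simp only [vChar, mul_smul_comm, smul_mul_assoc, Finset.mul_sum, Finset.sum_mul]
  congr 1
  rw [← Equiv.sum_comp (φ h).toEquiv (fun n => MonoidAlgebra.single (SemidirectProduct.inl n)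
    ((((charAct φ h χ n)⁻¹ : ℂˣ) : ℂ)) *
      MonoidAlgebra.single (SemidirectProduct.inr h) (1 : ℂ))]
  refine Finset.sum_congr rfl fun n _ => ?_
  simp [MonoidAlgebra.single_mul_single, charAct, SemidirectProduct.inl_aut, mul_assoc]

lemma vChar_mul_uChar_comm (χ : N →* ℂˣ) (ψ : charStab φ χ →* ℂˣ) [Fintype (charStab φ χ)] :
    uChar φ (charStab φ χ) ψ * vChar φ χ = vChar φ χ * uChar φ (charStab φ χ) ψ := by
  simp only [uChar, finsum_eq_sum_of_fintype, mul_smul_comm, smul_mul_assoc, Finset.mul_sum,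
    Finset.sum_mul]
  congr 1
  refine Finset.sum_congr rfl fun k _ => ?_
  have hk : charAct φ (k : H) χ = χ := k.2
  have hs : MonoidAlgebra.single (SemidirectProduct.inr (k : H) : N ⋊[φ] H)
      ((((ψ k)⁻¹ : ℂˣ) : ℂ)) = (((ψ k)⁻¹ : ℂˣ) : ℂ) •
        MonoidAlgebra.single (SemidirectProduct.inr (k : H)) (1 : ℂ) := by simp
  rw [hs, smul_mul_assoc, mul_smul_comm, single_inr_mul_vChar, hk]

lemma coeff_vChar_inr (χ : N →* ℂˣ) [DecidableEq H] (h : H) :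
    (vChar φ χ).coeff (SemidirectProduct.inr h) = if h = 1 then (Nat.card N : ℂ)⁻¹ else 0 := by
  classical
  simp only [vChar, MonoidAlgebra.coeff_smul_apply, MonoidAlgebra.coeff_sum,
    Finsupp.finsetSum_apply, MonoidAlgebra.coeff_single, Finsupp.single_apply,
    SemidirectProduct.ext_iff, SemidirectProduct.left_inl, SemidirectProduct.left_inr,
    SemidirectProduct.right_inl, SemidirectProduct.right_inr]
  by_cases hh : h = 1
  · simp [hh]
  · simp [hh, Ne.symm hh]

lemma coeff_vChar_mul_uChar_one (χ : N →* ℂˣ) (K : Subgroup H) [Fintype K] (ψ : K →* ℂˣ) :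
    (vChar φ χ * uChar φ K ψ).coeff 1 = (Nat.card K : ℂ)⁻¹ * (Nat.card N : ℂ)⁻¹ := by
  classical
  simp only [uChar, finsum_eq_sum_of_fintype, mul_smul_comm, Finset.mul_sum,
    MonoidAlgebra.coeff_smul_apply, MonoidAlgebra.coeff_sum, Finsupp.finsetSum_apply,
    MonoidAlgebra.coeff_mul_single_apply, one_mul, ← map_inv, coeff_vChar_inr]
  simp

end

/-- for a character `χ` of `N` with stabilizer `H_χ ≤ H` and a character
`ψ` of `H_χ`, the element `v_χ * u_ψ` is a primitive idempotent of `ℂ[N ⋊ H]`. -/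
theorem vChar_mul_uChar_primitive_idempotent
    (N H : Type*) [CommGroup N] [Fintype N] [CommGroup H] [Fintype H]
    (φ : H →* MulAut N) (χ : N →* ℂˣ) (ψ : (charStab φ χ) →* ℂˣ) :
    IsPrimitiveIdempotent (vChar φ χ * uChar φ (charStab φ χ) ψ) := by
  classical
  have : Fintype (charStab φ χ) := Fintype.ofFinite _
  have huv := vChar_mul_uChar_comm φ χ ψ
  have hvv : vChar φ χ * vChar φ χ = vChar φ χ := charIdempotent_mul_self _ _
  have huu : uChar φ (charStab φ χ) ψ * uChar φ (charStab φ χ) ψ = uChar φ (charStab φ χ) ψ := by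
    rw [uChar_eq_charIdempotent, charIdempotent_mul_self]
  have hku : ∀ k : charStab φ χ,
      MonoidAlgebra.single (SemidirectProduct.inr (k : H)) (1 : ℂ) * uChar φ (charStab φ χ) ψ
        = (ψ k : ℂ) • uChar φ (charStab φ χ) ψ := fun k => by
    rw [uChar_eq_charIdempotent]
    exact single_mul_charIdempotent (SemidirectProduct.inr.comp (charStab φ χ).subtype) ψ k
  have hvn : ∀ n : N, vChar φ χ * MonoidAlgebra.single (SemidirectProduct.inl n) (1 : ℂ)
      = (χ n : ℂ) • vChar φ χ := charIdempotent_mul_single _ _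
  have hne : ∀ h : H, h ∉ charStab φ χ → vChar φ χ * vChar φ (charAct φ h χ) = 0 :=
    fun h hh => charIdempotent_mul_of_ne _ fun he => hh he.symm
  set v := vChar φ χ
  set u := uChar φ (charStab φ χ) ψ
  have he : v * u * (v * u) = v * u := by
    rw [mul_assoc, ← mul_assoc u, huv, mul_assoc v u u, huu, ← mul_assoc, hvv]
  refine isPrimitiveIdempotent_of_corner_scalar (k := ℂ) ?_ he fun x => ?_
  · intro h0
    have h1 := coeff_vChar_mul_uChar_one φ χ (charStab φ χ) ψ
    rw [show vChar φ χ * uChar φ (charStab φ χ) ψ = 0 from h0] at h1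
    have h2 : (Nat.card (charStab φ χ) : ℂ) ≠ 0 := Nat.cast_ne_zero.mpr Nat.card_pos.ne'
    have h3 : (Nat.card N : ℂ) ≠ 0 := Nat.cast_ne_zero.mpr Nat.card_pos.ne'
    exact mul_ne_zero (inv_ne_zero h2) (inv_ne_zero h3) h1.symm
  · induction x using MonoidAlgebra.induction_linear with
    | zero => exact ⟨0, by simp⟩
    | add x y hx hy =>
      obtain ⟨a, ha⟩ := hx
      obtain ⟨b, hb⟩ := hy
      exact ⟨a + b, by rw [mul_add, add_mul, ha, hb, add_smul]⟩
    | single g r =>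
      have hg : MonoidAlgebra.single g r = r •
          (MonoidAlgebra.single (SemidirectProduct.inl g.left) (1 : ℂ) *
            MonoidAlgebra.single (SemidirectProduct.inr g.right) (1 : ℂ)) := by
        simp [MonoidAlgebra.single_mul_single]
      have hmove : v * u * MonoidAlgebra.single g r * (v * u) = (r * (χ g.left : ℂ)) •
          (u * (v * vChar φ (charAct φ g.right χ)) *
            (MonoidAlgebra.single (SemidirectProduct.inr g.right) (1 : ℂ) * u)) := by
        calc v * u * MonoidAlgebra.single g r * (v * u)
            = r • (u * (v * MonoidAlgebra.single (SemidirectProduct.inl g.left) (1 : ℂ)) *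
                (MonoidAlgebra.single (SemidirectProduct.inr g.right) (1 : ℂ) * v) * u) := by
              rw [hg, ← huv, mul_smul_comm, smul_mul_assoc, huv]
              simp only [← mul_assoc, huv]
          _ = _ := by
              rw [hvn, single_inr_mul_vChar, mul_smul_comm, smul_mul_assoc, smul_mul_assoc,
                smul_smul]
              simp only [mul_assoc]
      by_cases hh : g.right ∈ charStab φ χ
      · refine ⟨r * (χ g.left : ℂ) * (ψ ⟨g.right, hh⟩ : ℂ), ?_⟩
        have hχ : charAct φ g.right χ = χ := hh
        rw [hmove, hχ, hku ⟨g.right, hh⟩, mul_smul_comm, smul_smul]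
        change _ • (u * (v * v) * u) = _
        rw [hvv, huv, mul_assoc v, huu]
      · exact ⟨0, by rw [hmove, hne _ hh, mul_zero, zero_mul, smul_zero, zero_smul]⟩
end

section
/- Let χ₁ and χ₂ be characters of N lying in the same H-orbit (so, H being abelian, they have the same stabilizer H_α := H_{χ₁} = H_{χ₂}), and let ψ, ψ' : H_α →* ℂˣ be characters. Then there exists a ∈ ℂ[G] with (v_{χ₁} u_ψ) * a * (v_{χ₂} u_{ψ'}) ≠ 0 if and only if ψ = ψ'. (Equivalently, the primitive idempotents v_{χ₁} u_ψ and v_{χ₂} u_{ψ'} generate isomorphic minimal left ideals precisely when ψ = ψ'.) -/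
open SemidirectProduct

/-- The unnormalized idempotent `Σ_k ψ(k)⁻¹ · f(k)` of `ℂ[G]` attached to a homomorphism
`f : K → G` and a character `ψ` of `K`. -/
noncomputable def charSum {K G : Type*} [Group K] [Fintype K] [Group G]
    (f : K →* G) (ψ : K →* ℂˣ) : MonoidAlgebra ℂ G :=
  ∑ k : K, MonoidAlgebra.single (f k) (((ψ k)⁻¹ : ℂˣ) : ℂ)

section charSum

variable {K G : Type*} [Group K] [Fintype K] [Group G] (f : K →* G) (ψ : K →* ℂˣ)

lemma single_mul_charSum (k : K) :
    MonoidAlgebra.single (f k) (1 : ℂ) * charSum f ψ = (ψ k : ℂ) • charSum f ψ := by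
  unfold charSum
  rw [Finset.mul_sum, Finset.smul_sum]
  refine Fintype.sum_equiv (Equiv.mulLeft k) _ _ fun x => ?_
  simp [MonoidAlgebra.single_mul_single, MonoidAlgebra.smul_single, mul_left_comm (ψ k : ℂ)]

lemma charSum_mul_single (k : K) :
    charSum f ψ * MonoidAlgebra.single (f k) (1 : ℂ) = (ψ k : ℂ) • charSum f ψ := by
  unfold charSum
  rw [Finset.sum_mul, Finset.smul_sum]
  refine Fintype.sum_equiv (Equiv.mulRight k) _ _ fun x => ?_
  simp [MonoidAlgebra.single_mul_single, MonoidAlgebra.smul_single, mul_comm]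

lemma charSum_mul_self : charSum f ψ * charSum f ψ = (Nat.card K : ℂ) • charSum f ψ := by
  have h : ∀ k : K, MonoidAlgebra.single (f k) (((ψ k)⁻¹ : ℂˣ) : ℂ) * charSum f ψ
      = charSum f ψ := fun k => by
    have : MonoidAlgebra.single (f k) (((ψ k)⁻¹ : ℂˣ) : ℂ)
        = (((ψ k)⁻¹ : ℂˣ) : ℂ) • MonoidAlgebra.single (f k) (1 : ℂ) := by
      simp [MonoidAlgebra.smul_single]
    rw [this, smul_mul_assoc, single_mul_charSum, smul_smul, Units.inv_mul, one_smul]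
  conv_lhs => enter [1]; unfold charSum
  rw [Finset.sum_mul, Finset.sum_congr rfl fun k _ => h k]
  simp [Nat.cast_smul_eq_nsmul]

lemma charSum_mul_charSum_of_ne {ψ ψ' : K →* ℂˣ} (hne : ψ ≠ ψ') :
    charSum f ψ * charSum f ψ' = 0 := by
  obtain ⟨k, hk⟩ := DFunLike.ne_iff.mp hne
  have h : (ψ k : ℂ) • (charSum f ψ * charSum f ψ')
      = (ψ' k : ℂ) • (charSum f ψ * charSum f ψ') := by
    rw [← smul_mul_assoc, ← charSum_mul_single, mul_assoc, single_mul_charSum, mul_smul_comm]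
  rw [← sub_eq_zero, ← sub_smul] at h
  exact (smul_eq_zero.mp h).resolve_left (sub_ne_zero.mpr fun e => hk (Units.ext e))

end charSum

section semidirect

variable {N H : Type*} [CommGroup N] [CommGroup H] (φ : H →* MulAut N)

lemma commute_charSum_inr_single_inr {K : Subgroup H} [Fintype K] (ψ : K →* ℂˣ) (h : H) :
    Commute (charSum ((inr : H →* N ⋊[φ] H).comp K.subtype) ψ)
      (MonoidAlgebra.single (inr h : N ⋊[φ] H) (1 : ℂ)) := by
  refine Commute.sum_left _ _ _ fun k _ => ?_
  simp [Commute, SemiconjBy, MonoidAlgebra.single_mul_single, ← map_mul, mul_comm]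

lemma uChar_eq_smul_charSum (K : Subgroup H) [Fintype K] (ψ : K →* ℂˣ) :
    uChar φ K ψ
      = (Nat.card K : ℂ)⁻¹ • charSum ((inr : H →* N ⋊[φ] H).comp K.subtype) ψ := by
  rw [uChar, finsum_eq_sum_of_fintype]
  rfl

variable [Fintype N]

lemma single_inr_mul_charSum_inl (h : H) (χ : N →* ℂˣ) :
    MonoidAlgebra.single (inr h : N ⋊[φ] H) (1 : ℂ) * charSum inl χ
      = charSum inl (charAct φ h χ) * MonoidAlgebra.single (inr h : N ⋊[φ] H) (1 : ℂ) := by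
  unfold charSum
  rw [Finset.mul_sum, Finset.sum_mul]
  refine Fintype.sum_equiv (φ h).toEquiv _ _ fun x => ?_
  have e : (inr h * inl x : N ⋊[φ] H) = inl (φ h x) * inr h := by
    rw [inl_aut]; simp
  simp [MonoidAlgebra.single_mul_single, e, charAct]

lemma commute_single_inr_charSum_inl {χ : N →* ℂˣ} {h : H} (hh : h ∈ charStab φ χ) :
    Commute (MonoidAlgebra.single (inr h : N ⋊[φ] H) (1 : ℂ)) (charSum inl χ) := by
  have hh' : charAct φ h χ = χ := hh
  have := single_inr_mul_charSum_inl φ h χ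
  rwa [hh'] at this

lemma commute_charSum_inr_charSum_inl {χ : N →* ℂˣ} {K : Subgroup H} [Fintype K]
    (hK : K ≤ charStab φ χ) (ψ : K →* ℂˣ) :
    Commute (charSum ((inr : H →* N ⋊[φ] H).comp K.subtype) ψ) (charSum inl χ) := by
  refine Commute.sum_left _ _ _ fun k _ => ?_
  have := (commute_single_inr_charSum_inl φ (hK k.2)).smul_left (((ψ k)⁻¹ : ℂˣ) : ℂ)
  simpa [MonoidAlgebra.smul_single] using this

lemma vChar_eq_smul_charSum (χ : N →* ℂˣ) :
    vChar φ χ = (Nat.card N : ℂ)⁻¹ • charSum inl χ := rfl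

lemma charSum_inl_mul_charSum_inr_ne_zero (χ : N →* ℂˣ) (K : Subgroup H) [Fintype K]
    (ψ : K →* ℂˣ) :
    charSum inl χ * charSum ((inr : H →* N ⋊[φ] H).comp K.subtype) ψ ≠ 0 := by
  classical
  intro h0
  have h1 : (charSum inl χ * charSum ((inr : H →* N ⋊[φ] H).comp K.subtype) ψ).coeff 1 = 1 := by
    have e : ∀ (n : N) (k : K), (inl n * inr (k : H) : N ⋊[φ] H) = 1 ↔ n = 1 ∧ k = 1 := by
      intro n k
      simp [SemidirectProduct.ext_iff]
    unfold charSum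
    rw [Finset.sum_mul_sum]
    simp [MonoidAlgebra.single_mul_single, Finsupp.single_apply, e, ite_and]
  rw [h0] at h1
  simp at h1

lemma charSum_mul_mul_charSum_eq_zero {χ₁ χ₂ : N →* ℂˣ} {K : Subgroup H} [Fintype K]
    (h₁ : K ≤ charStab φ χ₁) (h₂ : K ≤ charStab φ χ₂) {ψ ψ' : K →* ℂˣ} (hne : ψ ≠ ψ')
    (a : MonoidAlgebra ℂ (N ⋊[φ] H)) :
    (charSum inl χ₁ * charSum ((inr : H →* N ⋊[φ] H).comp K.subtype) ψ) * a *
      (charSum inl χ₂ * charSum ((inr : H →* N ⋊[φ] H).comp K.subtype) ψ') = 0 := by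
  set U := charSum ((inr : H →* N ⋊[φ] H).comp K.subtype) ψ
  set U' := charSum ((inr : H →* N ⋊[φ] H).comp K.subtype) ψ'
  induction a using MonoidAlgebra.induction_linear with
  | zero => simp
  | add a b ha hb => rw [mul_add, add_mul, ha, hb, add_zero]
  | single g r =>
    have hg : (MonoidAlgebra.single g r : MonoidAlgebra ℂ (N ⋊[φ] H))
        = r • (MonoidAlgebra.single (inl g.left) 1 * MonoidAlgebra.single (inr g.right) 1) := by
      simp [MonoidAlgebra.single_mul_single, MonoidAlgebra.smul_single]
    have hU₁ : Commute U (charSum inl χ₁) := commute_charSum_inr_charSum_inl φ h₁ ψ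
    have hU'₁ : Commute U' (charSum inl χ₁) := commute_charSum_inr_charSum_inl φ h₁ ψ'
    have hU'₂ : Commute U' (charSum inl χ₂) := commute_charSum_inr_charSum_inl φ h₂ ψ'
    have hU'g : Commute U' (MonoidAlgebra.single (inr g.right) 1) :=
      commute_charSum_inr_single_inr φ ψ' g.right
    have hUU' : U * U' = 0 := charSum_mul_charSum_of_ne _ hne
    rw [hg, ← hU₁.eq, ← hU'₂.eq, mul_smul_comm, smul_mul_assoc, ← mul_assoc, ← mul_assoc,
      mul_assoc U, charSum_mul_single, mul_smul_comm, smul_mul_assoc, smul_mul_assoc,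
      mul_assoc (U * _), ← hU'g.eq, ← mul_assoc, mul_assoc U, ← hU'₁.eq, ← mul_assoc, hUU']
    simp

end semidirect

/-- for characters `χ₁, χ₂` of `N` in the same `H`-orbit, with common
stabilizer `Hα`, and characters `ψ, ψ'` of `Hα`, there exists `a ∈ ℂ[G]` with
`(v_{χ₁} u_ψ) * a * (v_{χ₂} u_{ψ'}) ≠ 0` if and only if `ψ = ψ'`. -/
theorem vChar_uChar_linked_iff
    (N H : Type*) [CommGroup N] [Fintype N] [CommGroup H] [Fintype H]
    (φ : H →* MulAut N) (χ₁ χ₂ : N →* ℂˣ)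
    (horb : ∃ h : H, charAct φ h χ₁ = χ₂)
    (Hα : Subgroup H) (hα₁ : charStab φ χ₁ = Hα) (hα₂ : charStab φ χ₂ = Hα)
    (ψ ψ' : Hα →* ℂˣ) :
    (∃ a : MonoidAlgebra ℂ (N ⋊[φ] H),
        (vChar φ χ₁ * uChar φ Hα ψ) * a * (vChar φ χ₂ * uChar φ Hα ψ') ≠ 0) ↔
      ψ = ψ' := by
  have : Fintype Hα := Fintype.ofFinite _
  have hN : (Nat.card N : ℂ) ≠ 0 := Nat.cast_ne_zero.mpr Nat.card_pos.ne'
  have hK : (Nat.card Hα : ℂ) ≠ 0 := Nat.cast_ne_zero.mpr Nat.card_pos.ne'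
  simp only [vChar_eq_smul_charSum, uChar_eq_smul_charSum, smul_mul_assoc, mul_smul_comm,
    ne_eq, smul_eq_zero, inv_eq_zero, hN, hK, false_or]
  constructor
  · rintro ⟨a, ha⟩
    by_contra hne
    exact ha (charSum_mul_mul_charSum_eq_zero φ hα₁.ge hα₂.ge hne a)
  · rintro rfl
    obtain ⟨h, rfl⟩ := horb
    refine ⟨MonoidAlgebra.single (inr h⁻¹) 1, ?_⟩
    set U := charSum ((inr : H →* N ⋊[φ] H).comp Hα.subtype) ψ with hUdef
    set V : MonoidAlgebra ℂ (N ⋊[φ] H) := charSum inl χ₁ with hVdef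
    have hconj : MonoidAlgebra.single (inr h⁻¹ : N ⋊[φ] H) (1 : ℂ)
        * charSum inl (charAct φ h χ₁) = V * MonoidAlgebra.single (inr h⁻¹) 1 := by
      rw [single_inr_mul_charSum_inl, ← charAct_mul, inv_mul_cancel, charAct_one]
    have hUV : Commute U V := commute_charSum_inr_charSum_inl φ hα₁.ge ψ
    have hUh : Commute U (MonoidAlgebra.single (inr h⁻¹) 1) :=
      commute_charSum_inr_single_inr φ ψ h⁻¹
    have key : (V * U) * MonoidAlgebra.single (inr h⁻¹) 1 *
        (charSum inl (charAct φ h χ₁) * U)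
        = ((Nat.card N : ℂ) * (Nat.card Hα : ℂ)) •
          (V * U * MonoidAlgebra.single (inr h⁻¹) 1) := by
      calc _ = V * U * (MonoidAlgebra.single (inr h⁻¹) 1 * charSum inl (charAct φ h χ₁)) * U := by
            simp only [mul_assoc]
        _ = V * (U * V) * (MonoidAlgebra.single (inr h⁻¹) 1 * U) := by
            rw [hconj]; simp only [mul_assoc]
        _ = (V * V) * (U * U) * MonoidAlgebra.single (inr h⁻¹) 1 := by
            rw [hUV.eq, ← hUh.eq]; simp only [mul_assoc]
        _ = _ := by
            rw [hVdef, hUdef, charSum_mul_self, charSum_mul_self]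
            simp only [smul_mul_assoc, mul_smul_comm, smul_smul]
            rw [mul_comm (Nat.card N : ℂ)]
    rw [key, smul_eq_zero, not_or]
    refine ⟨mul_ne_zero hN hK, fun h0 => ?_⟩
    refine charSum_inl_mul_charSum_inr_ne_zero φ χ₁ Hα ψ ?_
    have := congrArg (· * MonoidAlgebra.single (inr h : N ⋊[φ] H) (1 : ℂ)) h0
    simpa [mul_assoc, MonoidAlgebra.single_mul_single, ← map_mul,
      ← MonoidAlgebra.one_def] using this
end

section
/- For each H-orbit O of characters of N with common stabilizer H_O, and each character ψ : H_O →* ℂˣ, define J_{O,ψ} := Σ_{χ ∈ O} v_χ u_ψ ∈ ℂ[G]. Then: (a) each J_{O,ψ} is idempotent; (b) each J_{O,ψ} lies in the center of ℂ[G]; (c) J_{O,ψ} * J_{O',ψ'} = 0 whenever (O, ψ) ≠ (O', ψ'); and (d) the sum of J_{O,ψ} over all orbits O and all characters ψ of H_O equals the identity of ℂ[G]. -/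
open SemidirectProduct

open scoped Classical in
/-- `J_{O,ψ} = Σ_{χ' ∈ O} v_{χ'} u_ψ`, where `O` is the `H`-orbit of `χ`. -/
noncomputable def Jorb {N H : Type*} [Group N] [Fintype N] [Group H] [Fintype H]
    (φ : H →* MulAut N) (χ : N →* ℂˣ) (ψ : (charStab φ χ) →* ℂˣ) :
    MonoidAlgebra ℂ (N ⋊[φ] H) :=
  ∑ χ' ∈ Finset.image (fun h : H => charAct φ h χ) Finset.univ,
    vChar φ χ' * uChar φ (charStab φ χ) ψ

section CharIdem

variable {A R : Type*} [CommGroup A] [Fintype A] [Ring R] [Algebra ℂ R]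

/-- The element `(1/|A|) Σ_{a ∈ A} χ(a)⁻¹ f(a)` projecting onto the `χ`-isotypic part of the
representation `f` of the finite commutative group `A`. -/
noncomputable def charIdem (f : A →* R) (χ : A →* ℂˣ) : R :=
  (Nat.card A : ℂ)⁻¹ • ∑ a : A, (((χ a)⁻¹ : ℂˣ) : ℂ) • f a

lemma map_mul_charIdem (f : A →* R) (χ : A →* ℂˣ) (b : A) :
    f b * charIdem f χ = (χ b : ℂ) • charIdem f χ := by
  rw [charIdem, mul_smul_comm, smul_comm]
  congr 1
  rw [Finset.mul_sum, Finset.smul_sum]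
  refine Fintype.sum_equiv (Equiv.mulLeft b) _ _ fun a => ?_
  simp [smul_smul, mul_left_comm (χ b : ℂ)]

lemma commute_map_charIdem (f : A →* R) (χ : A →* ℂˣ) (b : A) :
    Commute (f b) (charIdem f χ) := by
  refine (Commute.sum_right _ _ _ fun a _ => Commute.smul_right ?_ _).smul_right _
  rw [Commute, SemiconjBy, ← map_mul, ← map_mul, mul_comm]

lemma charIdem_mul_self (f : A →* R) (χ : A →* ℂˣ) :
    charIdem f χ * charIdem f χ = charIdem f χ := by
  conv_lhs => enter [1]; rw [charIdem]
  rw [smul_mul_assoc, Finset.sum_mul]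
  simp_rw [smul_mul_assoc, map_mul_charIdem, smul_smul, ← Units.val_mul, inv_mul_cancel]
  simp [← Nat.cast_smul_eq_nsmul ℂ, smul_smul]

lemma charIdem_mul_of_ne (f : A →* R) {χ χ' : A →* ℂˣ} (h : χ ≠ χ') :
    charIdem f χ * charIdem f χ' = 0 := by
  obtain ⟨b, hb⟩ := DFunLike.ne_iff.mp h
  have key : (χ b : ℂ) • (charIdem f χ * charIdem f χ') =
      (χ' b : ℂ) • (charIdem f χ * charIdem f χ') := by
    rw [← smul_mul_assoc, ← map_mul_charIdem, (commute_map_charIdem f χ b).eq, mul_assoc,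
      map_mul_charIdem, mul_smul_comm]
  rw [← sub_eq_zero, ← sub_smul] at key
  exact (smul_eq_zero.mp key).resolve_left (sub_ne_zero.mpr fun e => hb (Units.ext e))

lemma finsum_charIdem (f : A →* R) : ∑ᶠ χ : A →* ℂˣ, charIdem f χ = 1 := by
  classical
  have := Fintype.ofFinite (A →* ℂˣ)
  rw [finsum_eq_sum_of_fintype]
  simp_rw [charIdem]
  rw [← Finset.smul_sum, Finset.sum_comm]
  have orth (a : A) : ∑ χ : A →* ℂˣ, (((χ a)⁻¹ : ℂˣ) : ℂ) =
      if a = 1 then (Nat.card A : ℂ) else 0 := by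
    split_ifs with h
    · rw [← CommGroup.card_monoidHom_of_hasEnoughRootsOfUnity A ℂ]
      simp [h]
    · obtain ⟨χ, hχ⟩ := CommGroup.exists_apply_ne_one_of_hasEnoughRootsOfUnity A ℂ h
      refine sum_hom_units_eq_zero ((Units.coeHom ℂ).comp (MonoidHom.eval a)⁻¹) fun e => hχ ?_
      simpa using DFunLike.congr_fun e χ
  simp_rw [← Finset.sum_smul, orth]
  simp [smul_smul]

end CharIdem

section SemidirectProduct

variable {N H : Type*} [CommGroup N] [CommGroup H] (φ : H →* MulAut N)

lemma uChar_eq_charIdem (K : Subgroup H) [Fintype K] (ψ : K →* ℂˣ) :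
    uChar φ K ψ =
      charIdem ((MonoidAlgebra.of ℂ (N ⋊[φ] H)).comp (inr.comp K.subtype)) ψ := by
  simp [uChar, charIdem, MonoidAlgebra.smul_single, finsum_eq_sum_of_fintype]

lemma uChar_mul_self (K : Subgroup H) [Finite K] (ψ : K →* ℂˣ) :
    uChar φ K ψ * uChar φ K ψ = uChar φ K ψ := by
  have := Fintype.ofFinite K
  rw [uChar_eq_charIdem, charIdem_mul_self]

lemma uChar_mul_of_ne (K : Subgroup H) [Finite K] {ψ ψ' : K →* ℂˣ} (h : ψ ≠ ψ') :
    uChar φ K ψ * uChar φ K ψ' = 0 := by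
  have := Fintype.ofFinite K
  rw [uChar_eq_charIdem, uChar_eq_charIdem, charIdem_mul_of_ne _ h]

lemma uChar_mul_of_not_heq {K₁ K₂ : Subgroup H} [Finite K₁] (hK : K₁ = K₂)
    {ψ₁ : K₁ →* ℂˣ} {ψ₂ : K₂ →* ℂˣ} (h : ¬ HEq ψ₁ ψ₂) : uChar φ K₁ ψ₁ * uChar φ K₂ ψ₂ = 0 := by
  subst hK
  exact uChar_mul_of_ne φ K₁ fun e => h (heq_of_eq e)

lemma finsum_uChar (K : Subgroup H) [Finite K] : ∑ᶠ ψ : K →* ℂˣ, uChar φ K ψ = 1 := by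
  have := Fintype.ofFinite K
  simp_rw [uChar_eq_charIdem, finsum_charIdem]

lemma commute_of_inr_uChar (h : H) (K : Subgroup H) [Finite K] (ψ : K →* ℂˣ) :
    Commute (MonoidAlgebra.of ℂ (N ⋊[φ] H) (inr h)) (uChar φ K ψ) := by
  have := Fintype.ofFinite K
  rw [uChar_eq_charIdem]
  refine (Commute.sum_right _ _ _ fun a _ => Commute.smul_right ?_ _).smul_right _
  simp only [MonoidHom.comp_apply, Commute, SemiconjBy, ← map_mul, mul_comm]

lemma mem_center_of_commute (x : MonoidAlgebra ℂ (N ⋊[φ] H))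
    (hl : ∀ n, Commute (MonoidAlgebra.of ℂ (N ⋊[φ] H) (inl n)) x)
    (hr : ∀ h, Commute (MonoidAlgebra.of ℂ (N ⋊[φ] H) (inr h)) x) :
    x ∈ Set.center (MonoidAlgebra ℂ (N ⋊[φ] H)) := by
  refine Semigroup.mem_center_iff.mpr fun y => ?_
  change Commute y x
  induction y using MonoidAlgebra.induction_on with
  | of g =>
    rw [← inl_left_mul_inr_right g, map_mul]
    exact (hl _).mul_left (hr _)
  | add a b ha hb => exact ha.add_left hb
  | smul r a ha => exact ha.smul_left r

lemma charAct_eq_of_mem_charStab (h k : H) (χ : N →* ℂˣ) (hk : k ∈ charStab φ χ) :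
    charAct φ k (charAct φ h χ) = charAct φ h χ := by
  rw [← charAct_mul, mul_comm, charAct_mul, show charAct φ k χ = χ from hk]

lemma charStab_charAct (h : H) (χ : N →* ℂˣ) : charStab φ (charAct φ h χ) = charStab φ χ := by
  refine le_antisymm (fun k hk => ?_) fun k hk => charAct_eq_of_mem_charStab φ h k χ hk
  have := charAct_eq_of_mem_charStab φ h⁻¹ k _ hk
  rwa [← charAct_mul φ h⁻¹ h, inv_mul_cancel, charAct_one] at this

lemma range_charAct_eq_of_charAct_eq {χ₁ χ₂ : N →* ℂˣ} {h₁ h₂ : H}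
    (e : charAct φ h₁ χ₁ = charAct φ h₂ χ₂) :
    Set.range (fun h : H => charAct φ h χ₁) = Set.range (fun h : H => charAct φ h χ₂) := by
  have e' : χ₁ = charAct φ (h₁⁻¹ * h₂) χ₂ := by
    rw [charAct_mul, ← e, ← charAct_mul, inv_mul_cancel, charAct_one]
  subst e'
  simp_rw [← charAct_mul]
  exact (Equiv.mulRight (h₁⁻¹ * h₂)).surjective.range_comp (fun h => charAct φ h χ₂)

lemma charStab_eq_of_range_eq {χ₁ χ₂ : N →* ℂˣ}
    (h : Set.range (fun h : H => charAct φ h χ₁) = Set.range (fun h : H => charAct φ h χ₂)) :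
    charStab φ χ₁ = charStab φ χ₂ := by
  obtain ⟨k, rfl⟩ : χ₁ ∈ Set.range (fun h : H => charAct φ h χ₂) := h ▸ ⟨1, charAct_one φ χ₁⟩
  exact charStab_charAct φ k χ₂

variable [Fintype N]

lemma vChar_eq_charIdem (χ : N →* ℂˣ) :
    vChar φ χ = charIdem ((MonoidAlgebra.of ℂ (N ⋊[φ] H)).comp inl) χ := by
  simp [vChar, charIdem, MonoidAlgebra.smul_single]

lemma vChar_mul_of_ne {χ χ' : N →* ℂˣ} (h : χ ≠ χ') : vChar φ χ * vChar φ χ' = 0 := by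
  simp_rw [vChar_eq_charIdem, charIdem_mul_of_ne _ h]

lemma commute_of_inl_vChar (n : N) (χ : N →* ℂˣ) :
    Commute (MonoidAlgebra.of ℂ (N ⋊[φ] H) (inl n)) (vChar φ χ) := by
  rw [vChar_eq_charIdem]
  exact commute_map_charIdem ((MonoidAlgebra.of ℂ (N ⋊[φ] H)).comp inl) χ n

lemma of_inr_mul_vChar (h : H) (χ : N →* ℂˣ) :
    MonoidAlgebra.of ℂ (N ⋊[φ] H) (inr h) * vChar φ χ =
      vChar φ (charAct φ h χ) * MonoidAlgebra.of ℂ (N ⋊[φ] H) (inr h) := by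
  rw [vChar, vChar, mul_smul_comm, smul_mul_assoc, Finset.mul_sum, Finset.sum_mul]
  congr 1
  refine Fintype.sum_equiv (φ h).toEquiv _ _ fun n => ?_
  simp [charAct, inl_aut, MonoidAlgebra.single_mul_single]

lemma commute_uChar_vChar (K : Subgroup H) [Finite K] (ψ : K →* ℂˣ) (χ : N →* ℂˣ)
    (hK : ∀ k ∈ K, charAct φ k χ = χ) : Commute (uChar φ K ψ) (vChar φ χ) := by
  have := Fintype.ofFinite K
  rw [uChar_eq_charIdem]
  refine (Commute.sum_left _ _ _ fun a _ => Commute.smul_left ?_ _).smul_left _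
  exact (of_inr_mul_vChar φ (a : H) χ).trans (by rw [hK _ a.2]; rfl)

variable [Fintype H]

open scoped Classical in
/-- The sum of the idempotents `v_{χ'}` over the `H`-orbit of `χ`. -/
noncomputable def vOrbit (χ : N →* ℂˣ) : MonoidAlgebra ℂ (N ⋊[φ] H) :=
  ∑ χ' ∈ Finset.image (fun h : H => charAct φ h χ) Finset.univ, vChar φ χ'

lemma Jorb_eq (χ : N →* ℂˣ) (ψ : charStab φ χ →* ℂˣ) :
    Jorb φ χ ψ = vOrbit φ χ * uChar φ (charStab φ χ) ψ := by
  rw [Jorb, vOrbit, Finset.sum_mul]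

lemma commute_of_inr_vOrbit (h : H) (χ : N →* ℂˣ) :
    Commute (MonoidAlgebra.of ℂ (N ⋊[φ] H) (inr h)) (vOrbit φ χ) := by
  classical
  rw [Commute, SemiconjBy, vOrbit, Finset.mul_sum, Finset.sum_mul]
  simp_rw [of_inr_mul_vChar]
  refine Finset.sum_bij (fun χ' _ => charAct φ h χ') ?_ ?_ ?_ fun _ _ => rfl
  · simp only [Finset.mem_image, Finset.mem_univ, true_and]
    rintro _ ⟨k, rfl⟩
    exact ⟨h * k, charAct_mul ..⟩
  · intro a _ b _ hab
    simpa [← charAct_mul, charAct_one] using congrArg (charAct φ h⁻¹) hab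
  · simp only [Finset.mem_image, Finset.mem_univ, true_and]
    rintro _ ⟨k, rfl⟩
    exact ⟨charAct φ (h⁻¹ * k) χ, ⟨_, rfl⟩, by rw [← charAct_mul, mul_inv_cancel_left]⟩

lemma vOrbit_mem_center (χ : N →* ℂˣ) :
    vOrbit φ χ ∈ Set.center (MonoidAlgebra ℂ (N ⋊[φ] H)) :=
  mem_center_of_commute φ _
    (fun n => Commute.sum_right _ _ _ fun _ _ => commute_of_inl_vChar φ n _)
    fun h => commute_of_inr_vOrbit φ h χ

lemma vOrbit_mul_self (χ : N →* ℂˣ) : vOrbit φ χ * vOrbit φ χ = vOrbit φ χ := by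
  classical
  rw [vOrbit, Finset.sum_mul_sum]
  refine Finset.sum_congr rfl fun a ha => ?_
  rw [Finset.sum_eq_single_of_mem a ha fun b _ hb => vChar_mul_of_ne φ hb.symm,
    vChar_eq_charIdem, charIdem_mul_self]

lemma vOrbit_mul_of_range_ne {χ₁ χ₂ : N →* ℂˣ}
    (h : Set.range (fun h : H => charAct φ h χ₁) ≠ Set.range (fun h : H => charAct φ h χ₂)) :
    vOrbit φ χ₁ * vOrbit φ χ₂ = 0 := by
  classical
  rw [vOrbit, vOrbit, Finset.sum_mul_sum]
  refine Finset.sum_eq_zero fun a ha => Finset.sum_eq_zero fun b hb => vChar_mul_of_ne φ ?_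
  obtain ⟨h₁, -, rfl⟩ := Finset.mem_image.mp ha
  obtain ⟨h₂, -, rfl⟩ := Finset.mem_image.mp hb
  exact fun e => h (range_charAct_eq_of_charAct_eq φ e)

lemma Jorb_mul (χ₁ χ₂ : N →* ℂˣ) (ψ₁ : charStab φ χ₁ →* ℂˣ) (ψ₂ : charStab φ χ₂ →* ℂˣ) :
    Jorb φ χ₁ ψ₁ * Jorb φ χ₂ ψ₂ = vOrbit φ χ₁ * vOrbit φ χ₂ *
      (uChar φ (charStab φ χ₁) ψ₁ * uChar φ (charStab φ χ₂) ψ₂) := by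
  have hc : Commute (uChar φ (charStab φ χ₁) ψ₁) (vOrbit φ χ₂) :=
    Semigroup.mem_center_iff.mp (vOrbit_mem_center φ χ₂) _
  rw [Jorb_eq, Jorb_eq, hc.mul_mul_mul_comm]

lemma Jorb_mem_center (χ : N →* ℂˣ) (ψ : charStab φ χ →* ℂˣ) :
    Jorb φ χ ψ ∈ Set.center (MonoidAlgebra ℂ (N ⋊[φ] H)) := by
  classical
  refine mem_center_of_commute φ _ (fun n => Commute.sum_right _ _ _ fun χ' hχ' => ?_) fun h => ?_
  · obtain ⟨h, -, rfl⟩ := Finset.mem_image.mp hχ'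
    have huv := commute_uChar_vChar φ (charStab φ χ) ψ (charAct φ h χ)
      fun k => charAct_eq_of_mem_charStab φ h k χ
    have hv : MonoidAlgebra.of ℂ (N ⋊[φ] H) (inl n) * vChar φ (charAct φ h χ) =
        (charAct φ h χ n : ℂ) • vChar φ (charAct φ h χ) := by
      rw [vChar_eq_charIdem]
      exact map_mul_charIdem ((MonoidAlgebra.of ℂ (N ⋊[φ] H)).comp inl) _ n
    rw [Commute, SemiconjBy, ← mul_assoc, hv, ← huv.eq, mul_assoc,
      ← (commute_of_inl_vChar φ n _).eq, hv, smul_mul_assoc, mul_smul_comm, huv.eq]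
  · rw [Jorb_eq]
    exact (commute_of_inr_vOrbit φ h χ).mul_right (commute_of_inr_uChar φ h _ ψ)

end SemidirectProduct

/-- the elements `J_{O,ψ} = Σ_{χ' ∈ O} v_{χ'} u_ψ` are idempotent (a),
central (b), pairwise orthogonal for distinct pairs `(O, ψ)` (c), and their sum over
all orbits `O` and all characters `ψ` of `H_O` is the identity of `ℂ[G]` (d); the sum
over all pairs `(O, ψ)` is expressed as the sum over all characters `χ` of `N` (each
orbit being counted once for each of its elements via its own `v_χ`) of the sum over
characters `ψ` of `H_χ` of `v_χ u_ψ`. -/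
theorem Jorb_central_orthogonal_idempotents_sum_one
    (N H : Type*) [CommGroup N] [Fintype N] [CommGroup H] [Fintype H]
    (φ : H →* MulAut N) :
    (∀ (χ : N →* ℂˣ) (ψ : (charStab φ χ) →* ℂˣ),
      Jorb φ χ ψ * Jorb φ χ ψ = Jorb φ χ ψ) ∧
    (∀ (χ : N →* ℂˣ) (ψ : (charStab φ χ) →* ℂˣ),
      Jorb φ χ ψ ∈ Set.center (MonoidAlgebra ℂ (N ⋊[φ] H))) ∧
    (∀ (χ₁ χ₂ : N →* ℂˣ) (ψ₁ : (charStab φ χ₁) →* ℂˣ) (ψ₂ : (charStab φ χ₂) →* ℂˣ),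
      ¬ (Set.range (fun h : H => charAct φ h χ₁) = Set.range (fun h : H => charAct φ h χ₂) ∧
          HEq ψ₁ ψ₂) →
        Jorb φ χ₁ ψ₁ * Jorb φ χ₂ ψ₂ = 0) ∧
    (∑ᶠ χ : N →* ℂˣ, ∑ᶠ ψ : (charStab φ χ) →* ℂˣ,
        vChar φ χ * uChar φ (charStab φ χ) ψ = 1) := by
  refine ⟨fun χ ψ => ?_, Jorb_mem_center φ, fun χ₁ χ₂ ψ₁ ψ₂ hne => ?_, ?_⟩
  · rw [Jorb_mul, vOrbit_mul_self, uChar_mul_self, Jorb_eq]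
  · rw [Jorb_mul]
    by_cases hr : Set.range (fun h : H => charAct φ h χ₁) =
        Set.range (fun h : H => charAct φ h χ₂)
    · rw [uChar_mul_of_not_heq φ (charStab_eq_of_range_eq φ hr) fun e => hne ⟨hr, e⟩, mul_zero]
    · rw [vOrbit_mul_of_range_ne φ hr, zero_mul]
  · have hsum (χ : N →* ℂˣ) :
        ∑ᶠ ψ : charStab φ χ →* ℂˣ, vChar φ χ * uChar φ (charStab φ χ) ψ = vChar φ χ := by
      rw [← mul_finsum' _ _ (Set.toFinite _), finsum_uChar, mul_one]
    simp_rw [hsum, vChar_eq_charIdem, finsum_charIdem]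
end

section
/- Let N and H be finite abelian groups and G = N ⋊[φ] H. Then the number of conjugacy classes of G equals the sum, over the H-orbits O of the action of H on the characters χ : N →* ℂˣ, of the order |H_O| of the common stabilizer H_O of the characters in O. Equivalently, the number of conjugacy classes of G is the sum of the numbers of conjugacy classes of the stability subgroups. -/
open SemidirectProduct

/-- A homomorphism `f` of finite abelian groups and its dual have cokernels of the same order. -/
lemma card_ker_mul_card_eq {M N : Type*} [CommGroup M] [Finite M] [CommGroup N] [Finite N]
    (f : M →* N) :
    Nat.card f.ker * Nat.card N = Nat.card M * Nat.card {χ : N →* ℂˣ // χ.comp f = 1} := by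
  have hdual : Nat.card {χ : N →* ℂˣ // χ.comp f = 1} = f.range.index := by
    have : NeZero (Monoid.exponent N) := ⟨Monoid.exponent_ne_zero_of_finite⟩
    rw [Subgroup.index_eq_card, ← CommGroup.card_domRestrictHom_ker (M := ℂ) f.range]
    refine Nat.card_congr (Equiv.subtypeEquivRight fun χ ↦ ?_)
    simp [MonoidHom.mem_ker, MonoidHom.ext_iff]
  rw [hdual, ← f.range.card_mul_index, ← f.ker.card_mul_index, Subgroup.index_ker, mul_assoc]

section SemidirectProduct

variable {N H : Type*} [CommGroup N] [CommGroup H] (φ : H →* MulAut N)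

/-- The homomorphism `(n₁, n₂) ↦ (n₁ / φ(h₂) n₁) / (n₂ / φ(h₁) n₂)`, whose kernel consists of the
pairs such that `(n₁, h₁)` and `(n₂, h₂)` commute. -/
def commuteHom (h : H × H) : N × N →* N :=
  (MonoidHom.id N / (φ h.2).toMonoidHom).coprod (MonoidHom.id N / (φ h.1).toMonoidHom)⁻¹

lemma commuteHom_apply (h : H × H) (n : N × N) :
    commuteHom φ h n = (n.1 / φ h.2 n.1) / (n.2 / φ h.1 n.2) := by
  simp [commuteHom, div_eq_mul_inv]

lemma commute_iff_mem_ker_commuteHom (a b : N ⋊[φ] H) :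
    Commute a b ↔ (a.left, b.left) ∈ (commuteHom φ (a.right, b.right)).ker := by
  rw [MonoidHom.mem_ker, commuteHom_apply, div_eq_one, div_eq_div_iff_mul_eq_mul, Commute,
    SemiconjBy, SemidirectProduct.ext_iff]
  simp [mul_comm a.right]

lemma mem_charStab_iff (χ : N →* ℂˣ) (h : H) :
    h ∈ charStab φ χ ↔ ∀ n, χ (φ h n) = χ n := by
  rw [← inv_mem_iff]
  simp [← SetLike.mem_coe, charStab, charAct, MonoidHom.ext_iff]

lemma comp_commuteHom_eq_one_iff (χ : N →* ℂˣ) (h : H × H) :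
    χ.comp (commuteHom φ h) = 1 ↔ h.1 ∈ charStab φ χ ∧ h.2 ∈ charStab φ χ := by
  simp only [mem_charStab_iff, MonoidHom.ext_iff, MonoidHom.comp_apply, commuteHom_apply,
    map_div, MonoidHom.one_apply, div_eq_one]
  refine ⟨fun hχ ↦ ⟨fun n ↦ ?_, fun n ↦ ?_⟩, fun hχ n ↦ ?_⟩
  · simpa [div_eq_one, eq_comm (a := (1 : ℂˣ)), eq_comm (a := χ n)] using hχ (1, n)
  · simpa [div_eq_one, eq_comm (a := χ n)] using hχ (n, 1)
  · simp [hχ.1, hχ.2]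

/-- The elements of `H` carrying `χ` to `charAct φ h χ` form a coset of the stabilizer of `χ`. -/
def charActFiberEquiv (h : H) (χ : N →* ℂˣ) :
    {k : H // charAct φ k χ = charAct φ h χ} ≃ charStab φ χ :=
  (Equiv.mulLeft h⁻¹).subtypeEquiv fun k ↦ by
    change _ ↔ charAct φ (h⁻¹ * k) χ = χ
    rw [charAct_mul]
    refine ⟨fun hk ↦ by rw [hk, ← charAct_mul, inv_mul_cancel, charAct_one], fun hk ↦ ?_⟩
    simpa [← charAct_mul, charAct_one] using congrArg (charAct φ h) hk

lemma exists_charAct_orbit_representatives [Finite N] :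
    ∃ R : Finset (N →* ℂˣ),
      ∀ χ : N →* ℂˣ, ∃! χ₀, χ₀ ∈ R ∧ ∃ h : H, charAct φ h χ₀ = χ := by
  classical
  have := Fintype.ofFinite (N →* ℂˣ)
  let act : MulAction H (N →* ℂˣ) :=
    { smul := charAct φ, one_smul := charAct_one φ, mul_smul := charAct_mul φ }
  let s := MulAction.orbitRel H (N →* ℂˣ)
  have key (χ : N →* ℂˣ) (χ₀ : N →* ℂˣ) :
      (∃ h : H, charAct φ h χ₀ = χ) ↔ (⟦χ₀⟧ : Quotient s) = ⟦χ⟧ := by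
    rw [eq_comm, Quotient.eq]
    rfl
  refine ⟨Finset.univ.image fun χ ↦ (⟦χ⟧ : Quotient s).out, fun χ ↦ ?_⟩
  simp only [key]
  refine ⟨(⟦χ⟧ : Quotient s).out, ⟨by simp, Quotient.out_eq _⟩, ?_⟩
  rintro χ₀ ⟨hχ₀, h⟩
  obtain ⟨χ₁, -, rfl⟩ := Finset.mem_image.mp hχ₀
  rw [Quotient.out_eq] at h
  rw [h]

lemma card_conjClasses_mul_card_eq_sum_sq [Finite N] [Fintype (N →* ℂˣ)] [Finite H] :
    Nat.card (ConjClasses (N ⋊[φ] H)) * Nat.card H =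
      ∑ χ : N →* ℂˣ, Nat.card (charStab φ χ) ^ 2 := by
  have := Fintype.ofFinite H
  have : Finite (N ⋊[φ] H) := Finite.of_equiv _ SemidirectProduct.equivProd.symm
  let e : {p : (N ⋊[φ] H) × (N ⋊[φ] H) // Commute p.1 p.2} ≃
      Σ h : H × H, (commuteHom φ h).ker :=
    { toFun p := ⟨(p.1.1.right, p.1.2.right), (p.1.1.left, p.1.2.left),
        (commute_iff_mem_ker_commuteHom φ _ _).1 p.2⟩
      invFun q := ⟨(⟨q.2.1.1, q.1.1⟩, ⟨q.2.1.2, q.1.2⟩),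
        (commute_iff_mem_ker_commuteHom φ _ _).2 q.2.2⟩
      left_inv _ := rfl
      right_inv _ := rfl }
  let e' : (Σ h : H × H, {χ : N →* ℂˣ // χ.comp (commuteHom φ h) = 1}) ≃
      Σ χ : N →* ℂˣ, charStab φ χ × charStab φ χ :=
    { toFun p := ⟨p.2.1, ⟨p.1.1, ((comp_commuteHom_eq_one_iff φ _ _).1 p.2.2).1⟩,
        ⟨p.1.2, ((comp_commuteHom_eq_one_iff φ _ _).1 p.2.2).2⟩⟩
      invFun q := ⟨(q.2.1.1, q.2.2.1), q.1,
        (comp_commuteHom_eq_one_iff φ _ _).2 ⟨q.2.1.2, q.2.2.2⟩⟩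
      left_inv _ := rfl
      right_inv _ := rfl }
  have hN : 0 < Nat.card N := Nat.card_pos
  have hker (h : H × H) : Nat.card (commuteHom φ h).ker =
      Nat.card N * Nat.card {χ : N →* ℂˣ // χ.comp (commuteHom φ h) = 1} := by
    refine Nat.eq_of_mul_eq_mul_right hN ?_
    rw [card_ker_mul_card_eq, Nat.card_prod]
    ring
  refine Nat.eq_of_mul_eq_mul_left hN ?_
  calc Nat.card N * (Nat.card (ConjClasses (N ⋊[φ] H)) * Nat.card H)
      = Nat.card (ConjClasses (N ⋊[φ] H)) * Nat.card (N ⋊[φ] H) := by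
        rw [SemidirectProduct.card]; ring
    _ = ∑ h : H × H, Nat.card (commuteHom φ h).ker := by
        rw [← card_comm_eq_card_conjClasses_mul_card, Nat.card_congr e, Nat.card_sigma]
    _ = Nat.card N * ∑ χ : N →* ℂˣ, Nat.card (charStab φ χ) ^ 2 := by
        simp only [hker, sq]
        simp only [← Finset.mul_sum]
        simp only [← Nat.card_prod (charStab φ _)]
        rw [← Nat.card_sigma, ← Nat.card_sigma, Nat.card_congr e']

lemma sum_sq_card_charStab [Fintype (N →* ℂˣ)] [Finite H] (R : Finset (N →* ℂˣ))
    (hR : ∀ χ : N →* ℂˣ, ∃! χ₀, χ₀ ∈ R ∧ ∃ h : H, charAct φ h χ₀ = χ) :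
    ∑ χ : N →* ℂˣ, Nat.card (charStab φ χ) ^ 2 =
      (∑ χ₀ ∈ R, Nat.card (charStab φ χ₀)) * Nat.card H := by
  classical
  have := Fintype.ofFinite H
  have hfiber (χ : N →* ℂˣ) :
      ((R ×ˢ (Finset.univ : Finset H)).filter fun p ↦ charAct φ p.2 p.1 = χ).card =
        Nat.card (charStab φ χ) := by
    obtain ⟨χ₀, ⟨hχ₀, h, rfl⟩, huniq⟩ := hR χ
    rw [charStab_charAct, ← Nat.card_congr (charActFiberEquiv φ h χ₀), Nat.card_eq_fintype_card,
      Fintype.card_subtype]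
    refine Finset.card_bij' (fun p _ ↦ p.2) (fun k _ ↦ (χ₀, k)) ?_ ?_ ?_ ?_
    · rintro ⟨χ₁, k⟩ hp
      simp only [Finset.mem_filter, Finset.mem_product, Finset.mem_univ, and_true,
        true_and] at hp ⊢
      rw [← hp.2, huniq χ₁ ⟨hp.1, k, hp.2⟩]
    · intro k hk
      simpa [hχ₀] using hk
    · rintro ⟨χ₁, k⟩ hp
      simp only [Finset.mem_filter, Finset.mem_product, Finset.mem_univ, and_true] at hp
      rw [huniq χ₁ ⟨hp.1, k, hp.2⟩]
    · simp
  calc ∑ χ : N →* ℂˣ, Nat.card (charStab φ χ) ^ 2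
      = ∑ χ : N →* ℂˣ,
          ∑ p ∈ (R ×ˢ (Finset.univ : Finset H)) with charAct φ p.2 p.1 = χ,
            Nat.card (charStab φ p.1) := by
        refine Finset.sum_congr rfl fun χ _ ↦ ?_
        rw [sq, ← smul_eq_mul, ← hfiber χ, Finset.sum_congr rfl (g := fun _ ↦ _),
          Finset.sum_const, hfiber χ]
        intro p hp
        rw [← (Finset.mem_filter.mp hp).2, charStab_charAct]
    _ = (∑ χ₀ ∈ R, Nat.card (charStab φ χ₀)) * Nat.card H := by
        rw [Finset.sum_fiberwise _ (fun p : (N →* ℂˣ) × H ↦ charAct φ p.2 p.1), Finset.sum_product, Finset.sum_mul]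
        simp [mul_comm]

end SemidirectProduct

/-- for `G = N ⋊[φ] H` with `N`, `H` finite abelian, the number of
conjugacy classes of `G` equals the sum, over the `H`-orbits of characters of `N`
(represented by a complete set `R` of orbit representatives), of the orders of the
stabilizers — equivalently, of the numbers of conjugacy classes of the stabilizers. -/
theorem card_conjClasses_semidirect
    (N H : Type*) [CommGroup N] [Fintype N] [CommGroup H] [Fintype H]
    (φ : H →* MulAut N) :
    (∃ R : Finset (N →* ℂˣ),
      ∀ χ : N →* ℂˣ, ∃! χ₀, χ₀ ∈ R ∧ ∃ h : H, charAct φ h χ₀ = χ) ∧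
    (∀ R : Finset (N →* ℂˣ),
      (∀ χ : N →* ℂˣ, ∃! χ₀, χ₀ ∈ R ∧ ∃ h : H, charAct φ h χ₀ = χ) →
        Nat.card (ConjClasses (N ⋊[φ] H)) = ∑ χ₀ ∈ R, Nat.card (charStab φ χ₀) ∧
        Nat.card (ConjClasses (N ⋊[φ] H)) =
          ∑ χ₀ ∈ R, Nat.card (ConjClasses (charStab φ χ₀))) := by
  have := Fintype.ofFinite (N →* ℂˣ)
  refine ⟨exists_charAct_orbit_representatives φ, fun R hR ↦ ?_⟩
  have hcard : Nat.card (ConjClasses (N ⋊[φ] H)) = ∑ χ₀ ∈ R, Nat.card (charStab φ χ₀) :=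
    Nat.eq_of_mul_eq_mul_right Nat.card_pos <|
      (card_conjClasses_mul_card_eq_sum_sq φ).trans (sum_sq_card_charStab φ R hR)
  refine ⟨hcard, hcard.trans (Finset.sum_congr rfl fun χ _ ↦ ?_)⟩
  exact Nat.card_congr ConjClasses.mkEquiv
end
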